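/- arXiv:2605.00650 — 2 statements merged into one kernel-verified Lean document; each statement's English description precedes it below -/
import Mathlib

section
/- Let f : ℝ^d → ℝ be differentiable with L-Lipschitz gradient, let w ∈ ℝ^d, let μ > 0, and let z be a standard Gaussian random vector in ℝ^d. Define the SPSA gradient estimate g_μ(z) = ((f(w + μz) − f(w − μz)) / (2μ)) · z. Then the bias of the estimator satisfies ‖E_z[g_μ(z)] − ∇f(w)‖ ≤ (L μ / 2) · E_z[‖z‖³]. -/
open MeasureTheory ProbabilityTheory

/-- The standard Gaussian measure `N(0, I_d)` on the Euclidean space `ℝ^d`,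
obtained from the product of `d` independent standard normals. -/
noncomputable def stdGaussianE (d : ℕ) : Measure (EuclideanSpace ℝ (Fin d)) :=
  (Measure.pi fun _ : Fin d => gaussianReal 0 1).map
    (EuclideanSpace.equiv (Fin d) ℝ).symm

section Spsa

variable {E : Type*} [NormedAddCommGroup E] [InnerProductSpace ℝ E]

/-- Second-order bound on the symmetric difference of a function with `L`-Lipschitz gradient. -/
lemma abs_symm_diff_sub_le_of_gradient_lipschitz [CompleteSpace E] {f : E → ℝ} {L : ℝ}
    (hf : Differentiable ℝ f)
    (hL : ∀ x y, ‖gradient f x - gradient f y‖ ≤ L * ‖x - y‖)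
    (w z : E) {μ : ℝ} (hμ : 0 ≤ μ) :
    |f (w + μ • z) - f (w - μ • z) - 2 * μ * inner ℝ (gradient f w) z|
      ≤ L * ‖z‖ ^ 2 * μ ^ 2 := by
  have hline (v : E) (t : ℝ) :
      HasDerivAt (fun t : ℝ => f (w + t • v)) (inner ℝ (gradient f (w + t • v)) v) t := by
    have hlin : HasDerivAt (fun t : ℝ => w + t • v) v t := by
      simpa using ((hasDerivAt_id t).smul_const v).const_add w
    exact (hf (w + t • v)).hasGradientAt.hasFDerivAt.comp_hasDerivAt t hlin
  have hinner (v : E) {t : ℝ} (ht : 0 ≤ t) :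
      |inner ℝ (gradient f (w + t • v) - gradient f w) v| ≤ L * t * ‖v‖ ^ 2 := by
    refine (abs_real_inner_le_norm _ _).trans ?_
    have h := hL (w + t • v) w
    rw [add_sub_cancel_left, norm_smul, Real.norm_of_nonneg ht] at h
    calc _ ≤ L * (t * ‖v‖) * ‖v‖ := by gcongr
      _ = _ := by ring
  have hderiv (t : ℝ) : HasDerivAt
      (fun t : ℝ => f (w + t • z) - f (w + t • (-z)) - 2 * t * inner ℝ (gradient f w) z)
      (inner ℝ (gradient f (w + t • z) - gradient f w) z
        - inner ℝ (gradient f (w + t • (-z)) - gradient f w) (-z)) t := by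
    have hlin := (((hasDerivAt_id t).const_mul 2).mul_const (inner ℝ (gradient f w) z))
    refine (((hline z t).sub (hline (-z) t)).sub hlin).congr_deriv ?_
    simp only [inner_sub_left, inner_neg_right]
    ring
  have hB (t : ℝ) :
      HasDerivAt (fun t : ℝ => L * ‖z‖ ^ 2 * t ^ 2) (L * ‖z‖ ^ 2 * (2 * t)) t := by
    simpa using (hasDerivAt_pow 2 t).const_mul (L * ‖z‖ ^ 2)
  have h := image_norm_le_of_norm_deriv_right_le_deriv_boundary (a := 0) (b := μ)
    (fun t _ => (hderiv t).continuousAt.continuousWithinAt)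
    (fun t _ => (hderiv t).hasDerivWithinAt) (by simp) hB
    (fun t ht => by
      have h₁ := hinner z ht.1
      have h₂ := hinner (-z) ht.1
      rw [norm_neg] at h₂
      rw [Real.norm_eq_abs]
      refine (abs_sub _ _).trans ?_
      linarith) (Set.right_mem_Icc.2 hμ)
  simpa [sub_eq_add_neg] using h

variable [FiniteDimensional ℝ E] [MeasurableSpace E] [BorelSpace E]

lemma integrable_inner_smul_stdGaussian (g : E) :
    Integrable (fun z : E => (inner ℝ g z : ℝ) • z) (stdGaussian E) := by
  refine ((IsGaussian.memLp_id (stdGaussian E) 2 (by simp)).integrable_norm_pow'.const_mul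
    ‖g‖).mono' (by fun_prop) (.of_forall fun z => ?_)
  rw [norm_smul, id, pow_two, ← mul_assoc]
  gcongr
  exact norm_inner_le_norm g z

/-- The standard Gaussian has identity second moment. -/
lemma integral_inner_smul_stdGaussian (g : E) :
    ∫ z, (inner ℝ g z : ℝ) • z ∂(stdGaussian E) = g := by
  refine ext_inner_left ℝ fun u => ?_
  rw [← integral_inner (integrable_inner_smul_stdGaussian g)]
  have h := covarianceBilin_apply (IsGaussian.memLp_id (stdGaussian E) 2 (by simp)) u g
  rw [covarianceBilin_stdGaussian] at h
  simp only [id, integral_id_stdGaussian, sub_zero] at h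
  rw [← innerSL_apply_apply ℝ u g, h]
  simp only [real_inner_smul_right, mul_comm]

lemma norm_integral_spsa_sub_gradient_le {f : E → ℝ} {L : ℝ}
    (hf : Differentiable ℝ f)
    (hL : ∀ x y, ‖gradient f x - gradient f y‖ ≤ L * ‖x - y‖)
    (w : E) {μ : ℝ} (hμ : 0 < μ) :
    ‖(∫ z, ((f (w + μ • z) - f (w - μ • z)) / (2 * μ)) • z ∂(stdGaussian E)) - gradient f w‖
      ≤ L * μ / 2 * ∫ z, ‖z‖ ^ 3 ∂(stdGaussian E) := by
  set G : E → E := fun z => ((f (w + μ • z) - f (w - μ • z)) / (2 * μ)) • z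
  set H : E → E := fun z => (inner ℝ (gradient f w) z : ℝ) • z
  have hH : Integrable H (stdGaussian E) := integrable_inner_smul_stdGaussian _
  have hbound (z : E) : ‖(G - H) z‖ ≤ L * μ / 2 * ‖z‖ ^ 3 := by
    have h := abs_symm_diff_sub_le_of_gradient_lipschitz hf hL w z hμ.le
    have hGH : (G - H) z = ((f (w + μ • z) - f (w - μ • z)
        - 2 * μ * inner ℝ (gradient f w) z) / (2 * μ)) • z := by
      simp only [G, H, Pi.sub_apply, ← sub_smul]
      congr 1
      field_simp
    rw [hGH, norm_smul, Real.norm_eq_abs, abs_div, abs_of_pos (by positivity : 0 < 2 * μ)]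
    calc _ ≤ L * ‖z‖ ^ 2 * μ ^ 2 / (2 * μ) * ‖z‖ := by gcongr
      _ = _ := by field_simp
  have hcube : Integrable (fun z : E => L * μ / 2 * ‖z‖ ^ 3) (stdGaussian E) :=
    (IsGaussian.memLp_id (stdGaussian E) (3 : ℕ) (by simp)).integrable_norm_pow'.const_mul _
  have hG_meas : Continuous G := by
    have := hf.continuous
    fun_prop
  have hGH : Integrable (G - H) (stdGaussian E) :=
    hcube.mono' (hG_meas.aestronglyMeasurable.sub hH.1) (.of_forall hbound)
  have hG : Integrable G (stdGaussian E) := by simpa using hGH.add hH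
  calc _ = ‖∫ z, (G - H) z ∂(stdGaussian E)‖ := by
        rw [integral_sub' hG hH, integral_inner_smul_stdGaussian]
    _ ≤ ∫ z, L * μ / 2 * ‖z‖ ^ 3 ∂(stdGaussian E) :=
        norm_integral_le_of_norm_le hcube (.of_forall hbound)
    _ = _ := integral_const_mul _ _

end Spsa

lemma stdGaussianE_eq_stdGaussian (d : ℕ) :
    stdGaussianE d = stdGaussian (EuclideanSpace ℝ (Fin d)) :=
  map_pi_eq_stdGaussian

/-- Bias bound for the SPSA gradient estimator: if `f` is differentiable with
`L`-Lipschitz gradient, `μ > 0`, and `z ∼ N(0, I_d)`, then with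
`g_μ(z) = ((f(w + μz) − f(w − μz)) / (2μ)) · z`,
`‖E_z[g_μ(z)] − ∇f(w)‖ ≤ (L μ / 2) E_z[‖z‖³]`. -/
theorem spsa_estimator_bias_bound
    (d : ℕ) (f : EuclideanSpace ℝ (Fin d) → ℝ) (L : ℝ)
    (hf : Differentiable ℝ f)
    (hL : ∀ x y : EuclideanSpace ℝ (Fin d), ‖gradient f x - gradient f y‖ ≤ L * ‖x - y‖)
    (w : EuclideanSpace ℝ (Fin d)) (μ : ℝ) (hμ : 0 < μ) :
    ‖(∫ z, ((f (w + μ • z) - f (w - μ • z)) / (2 * μ)) • z ∂(stdGaussianE d))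
        - gradient f w‖
      ≤ L * μ / 2 * ∫ z, ‖z‖ ^ 3 ∂(stdGaussianE d) := by
  rw [stdGaussianE_eq_stdGaussian]
  exact norm_integral_spsa_sub_gradient_le hf hL w hμ
end

section
/- Let z_1, …, z_n be independent standard Gaussian random vectors in ℝ^d, let Σ be a d×d diagonal matrix with strictly positive diagonal entries, let M = Σ^{-1/2}, let g ∈ ℝ^d be fixed, and define the averaged preconditioned estimator u = (1/n) Σ_{j=1}^n M z_j z_jᵀ M g. Then E[u] = Σ^{-1} g and E[‖u‖²] = (1 − 1/n) · (gᵀ Σ^{-2} g) + (1/n) · (tr(Σ^{-1}) · (gᵀ Σ^{-1} g) + 2 · (gᵀ Σ^{-2} g)); in particular E[‖u‖²] ≤ tr(Σ^{-1}) · (gᵀ Σ^{-1} g) + 2 · (gᵀ Σ^{-2} g). -/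
open MeasureTheory ProbabilityTheory Matrix

/-- The joint law of `n` i.i.d. standard Gaussian vectors in `ℝ^d`. -/
noncomputable def iidStdGaussian (n d : ℕ) : Measure (Fin n → Fin d → ℝ) :=
  Measure.pi fun _ => Measure.pi fun _ => gaussianReal 0 1

/-- `M = Σ^{-1/2}`: the diagonal matrix with entries `σ_i^{-1/2}`. -/
noncomputable def invSqrtDiag {d : ℕ} (σ : Fin d → ℝ) : Matrix (Fin d) (Fin d) ℝ :=
  Matrix.diagonal fun i => (Real.sqrt (σ i))⁻¹

section GaussianMoments

variable {ι : Type*} [Fintype ι]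

lemma integral_pow_eq_iteratedDeriv_stdGaussian (k : ℕ) :
    ∫ x, x ^ k ∂(gaussianReal 0 1) = iteratedDeriv k (fun t : ℝ => Real.exp (t ^ 2 / 2)) 0 := by
  have h := iteratedDeriv_mgf_zero (X := fun x : ℝ => x) (μ := gaussianReal 0 1) (by simp) k
  rw [mgf_fun_id_gaussianReal] at h
  simpa using h.symm

lemma deriv_mul_exp_sq_half {p p' : ℝ → ℝ} (hp : ∀ t, HasDerivAt p (p' t) t) :
    deriv (fun t => p t * Real.exp (t ^ 2 / 2))
      = fun t => (p' t + t * p t) * Real.exp (t ^ 2 / 2) := by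
  ext t
  have hq : HasDerivAt (fun t : ℝ => t ^ 2 / 2) t t := 
    ((hasDerivAt_pow 2 t).div_const 2).congr_deriv (by simp)
  refine ((hp t).mul hq.exp).deriv.trans ?_
  ring

lemma iteratedDeriv_one_exp_sq_half :
    iteratedDeriv 1 (fun t : ℝ => Real.exp (t ^ 2 / 2)) = fun t => t * Real.exp (t ^ 2 / 2) := by
  have h := deriv_mul_exp_sq_half (p := fun _ => 1) (p' := fun _ => 0)
    fun t => hasDerivAt_const t 1
  simpa [iteratedDeriv_one] using h

lemma iteratedDeriv_two_exp_sq_half :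
    iteratedDeriv 2 (fun t : ℝ => Real.exp (t ^ 2 / 2))
      = fun t => (1 + t * t) * Real.exp (t ^ 2 / 2) := by
  rw [iteratedDeriv_succ, iteratedDeriv_one_exp_sq_half,
    deriv_mul_exp_sq_half (p := fun t => t) fun t => hasDerivAt_id t]

lemma iteratedDeriv_four_exp_sq_half :
    iteratedDeriv 4 (fun t : ℝ => Real.exp (t ^ 2 / 2))
      = fun t => (3 + 6 * t ^ 2 + t ^ 4) * Real.exp (t ^ 2 / 2) := by
  have h₂ (t : ℝ) : HasDerivAt (fun t : ℝ => 1 + t * t) (2 * t) t := 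
    (((hasDerivAt_id t).mul (hasDerivAt_id t)).const_add 1).congr_deriv (by simp; ring)
  have h₃ (t : ℝ) : HasDerivAt (fun t : ℝ => 2 * t + t * (1 + t * t)) (3 + 3 * t ^ 2) t := 
    (((hasDerivAt_id t).const_mul 2).add ((hasDerivAt_id t).mul (h₂ t))).congr_deriv
      (by simp; ring)
  rw [iteratedDeriv_succ, iteratedDeriv_succ, iteratedDeriv_two_exp_sq_half,
    deriv_mul_exp_sq_half h₂, deriv_mul_exp_sq_half h₃]
  ext t
  ring

lemma integral_sq_stdGaussian : ∫ x, x ^ 2 ∂(gaussianReal 0 1) = 1 := by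
  rw [integral_pow_eq_iteratedDeriv_stdGaussian, iteratedDeriv_two_exp_sq_half]
  simp

lemma integral_pow_four_stdGaussian : ∫ x, x ^ 4 ∂(gaussianReal 0 1) = 3 := by
  rw [integral_pow_eq_iteratedDeriv_stdGaussian, iteratedDeriv_four_exp_sq_half]
  simp

lemma integrable_pow_gaussianReal (k : ℕ) :
    Integrable (fun x : ℝ => x ^ k) (gaussianReal 0 1) :=
  integrable_pow_of_mem_interior_integrableExpSet (X := fun x : ℝ => x) (by simp) k

lemma integrable_monomial_stdGaussian (e : ι → ℕ) :
    Integrable (fun x : ι → ℝ => ∏ i, x i ^ e i) (Measure.pi fun _ => gaussianReal 0 1) :=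
  Integrable.fintype_prod fun i => integrable_pow_gaussianReal (e i)

lemma integral_monomial_stdGaussian (e : ι → ℕ) :
    ∫ x : ι → ℝ, ∏ i, x i ^ e i ∂(Measure.pi fun _ => gaussianReal 0 1)
      = ∏ i, ∫ x, x ^ e i ∂(gaussianReal 0 1) :=
  integral_fintype_prod_eq_prod fun i (x : ℝ) => x ^ e i

variable [DecidableEq ι]

lemma mul_eq_monomial (a b : ι) (x : ι → ℝ) :
    x a * x b = ∏ i, x i ^ ((if i = a then 1 else 0) + (if i = b then 1 else 0)) := by
  simp_rw [pow_add, Finset.prod_mul_distrib]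
  simp [pow_ite]

lemma mul_mul_sq_eq_monomial (a b k : ι) (x : ι → ℝ) :
    x a * x b * x k ^ 2 = ∏ i, x i ^
      ((if i = a then 1 else 0) + (if i = b then 1 else 0) + (if i = k then 2 else 0)) := by
  simp_rw [pow_add, Finset.prod_mul_distrib]
  simp [pow_ite]

lemma integrable_mul_stdGaussian (a b : ι) :
    Integrable (fun x : ι → ℝ => x a * x b) (Measure.pi fun _ => gaussianReal 0 1) := by
  simp_rw [mul_eq_monomial a b]
  exact integrable_monomial_stdGaussian _

lemma integrable_mul_mul_sq_stdGaussian (a b k : ι) :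
    Integrable (fun x : ι → ℝ => x a * x b * x k ^ 2)
      (Measure.pi fun _ => gaussianReal 0 1) := by
  simp_rw [mul_mul_sq_eq_monomial a b k]
  exact integrable_monomial_stdGaussian _

lemma integral_mul_stdGaussian (a b : ι) :
    ∫ x : ι → ℝ, x a * x b ∂(Measure.pi fun _ => gaussianReal 0 1) = if a = b then 1 else 0 := by
  simp_rw [mul_eq_monomial a b]
  rw [integral_monomial_stdGaussian]
  split_ifs with hab
  · subst hab
    refine Finset.prod_eq_one fun i _ => ?_
    by_cases hi : i = a <;> simp [hi, integral_sq_stdGaussian]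
  · exact Finset.prod_eq_zero (Finset.mem_univ a) (by simp [hab])

lemma integral_mul_mul_sq_stdGaussian (a b k : ι) :
    ∫ x : ι → ℝ, x a * x b * x k ^ 2 ∂(Measure.pi fun _ => gaussianReal 0 1)
      = if a = b then (if a = k then 3 else 1) else 0 := by
  simp_rw [mul_mul_sq_eq_monomial a b k]
  rw [integral_monomial_stdGaussian]
  by_cases hab : a = b
  · subst hab
    by_cases hak : a = k
    · subst hak
      rw [Finset.prod_eq_single a (fun i _ hi => by simp [hi]) (by simp)]
      simp [integral_pow_four_stdGaussian]
    · simp only [hak, if_true, if_false]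
      refine Finset.prod_eq_one fun i _ => ?_
      by_cases hi : i = a
      · subst hi
        simp [hak, integral_sq_stdGaussian]
      · by_cases hk : i = k <;> simp [hi, hk, Ne.symm hak, integral_sq_stdGaussian]
  · rw [if_neg hab]
    by_cases hak : a = k
    · exact Finset.prod_eq_zero (Finset.mem_univ b)
        (by simp [Ne.symm hab, show b ≠ k from fun h => hab (hak.trans h.symm)])
    · exact Finset.prod_eq_zero (Finset.mem_univ a) (by simp [hab, hak])

end GaussianMoments

section LinearTimesCoordinate

variable {ι : Type*} [Fintype ι] (h : ι → ℝ) (m : ℝ) (k : ι)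

lemma dotProduct_mul_coord_eq_sum (x : ι → ℝ) :
    (x ⬝ᵥ h) * (m * x k) = ∑ a, h a * m * (x a * x k) := by
  rw [dotProduct, Finset.sum_mul]
  exact Finset.sum_congr rfl fun a _ => by ring

lemma sq_dotProduct_mul_coord_eq_sum (x : ι → ℝ) :
    ((x ⬝ᵥ h) * (m * x k)) ^ 2
      = ∑ a, ∑ b, h a * h b * m ^ 2 * (x a * x b * x k ^ 2) := by
  rw [mul_pow, sq (x ⬝ᵥ h), dotProduct, Finset.sum_mul_sum, Finset.sum_mul]
  refine Finset.sum_congr rfl fun a _ => ?_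
  rw [Finset.sum_mul]
  exact Finset.sum_congr rfl fun b _ => by ring

lemma memLp_two_dotProduct_mul_coord :
    MemLp (fun x : ι → ℝ => (x ⬝ᵥ h) * (m * x k)) 2 (Measure.pi fun _ => gaussianReal 0 1) := by
  classical
  rw [memLp_two_iff_integrable_sq (by unfold dotProduct; fun_prop)]
  simp_rw [sq_dotProduct_mul_coord_eq_sum]
  exact integrable_finsetSum _ fun a _ => integrable_finsetSum _ fun b _ =>
    (integrable_mul_mul_sq_stdGaussian a b k).const_mul _

lemma integral_dotProduct_mul_coord :
    ∫ x : ι → ℝ, (x ⬝ᵥ h) * (m * x k) ∂(Measure.pi fun _ => gaussianReal 0 1) = h k * m := by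
  classical
  simp_rw [dotProduct_mul_coord_eq_sum]
  rw [integral_finsetSum _ fun a _ => (integrable_mul_stdGaussian a k).const_mul _]
  simp [integral_const_mul, integral_mul_stdGaussian]

lemma integral_sq_dotProduct_mul_coord :
    ∫ x : ι → ℝ, ((x ⬝ᵥ h) * (m * x k)) ^ 2 ∂(Measure.pi fun _ => gaussianReal 0 1)
      = m ^ 2 * (∑ a, h a ^ 2 + 2 * h k ^ 2) := by
  classical
  simp_rw [sq_dotProduct_mul_coord_eq_sum]
  have hi (a b : ι) := (integrable_mul_mul_sq_stdGaussian a b k).const_mul (h a * h b * m ^ 2)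
  rw [integral_finsetSum _ fun a _ => integrable_finsetSum _ fun b _ => hi a b]
  have hs (a : ι) : ∫ x : ι → ℝ, ∑ b, h a * h b * m ^ 2 * (x a * x b * x k ^ 2)
      ∂(Measure.pi fun _ => gaussianReal 0 1)
      = m ^ 2 * (h a ^ 2 + 2 * if a = k then h a ^ 2 else 0) := by
    rw [integral_finsetSum _ fun b _ => hi a b]
    simp only [integral_const_mul, integral_mul_mul_sq_stdGaussian, mul_ite, mul_zero,
      Finset.sum_ite_eq, Finset.mem_univ, if_true]
    split_ifs <;> ring
  simp_rw [hs]
  rw [← Finset.mul_sum, Finset.sum_add_distrib, ← Finset.mul_sum]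
  simp

end LinearTimesCoordinate

section SampleMean

variable {Ω : Type*} [MeasurableSpace Ω] {μ : Measure Ω} [IsProbabilityMeasure μ]
  {n : ℕ} {X : Ω → ℝ}

lemma integrable_sum_comp_eval (hX : Integrable X μ) :
    Integrable (fun z : Fin n → Ω => ∑ j, X (z j)) (Measure.pi fun _ => μ) :=
  integrable_finsetSum _ fun _ _ => integrable_comp_eval hX

lemma integral_sum_comp_eval (hX : Integrable X μ) :
    ∫ z : Fin n → Ω, ∑ j, X (z j) ∂(Measure.pi fun _ => μ) = n * ∫ x, X x ∂μ := by
  rw [integral_finsetSum _ fun _ _ => integrable_comp_eval hX]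
  simp [integral_comp_eval (μ := fun _ : Fin n => μ) hX.aestronglyMeasurable]

lemma memLp_two_sum_comp_eval (hX : MemLp X 2 μ) :
    MemLp (fun z : Fin n → Ω => ∑ j, X (z j)) 2 (Measure.pi fun _ => μ) :=
  memLp_finsetSum _ fun j _ =>
    hX.comp_measurePreserving (measurePreserving_eval (fun _ : Fin n => μ) j)

lemma integral_sq_sampleMean (hn : 0 < n) (hX : MemLp X 2 μ) :
    ∫ z : Fin n → Ω, ((1 / (n : ℝ)) * ∑ j, X (z j)) ^ 2 ∂(Measure.pi fun _ => μ)
      = (1 - 1 / (n : ℝ)) * (∫ x, X x ∂μ) ^ 2 + (1 / (n : ℝ)) * ∫ x, X x ^ 2 ∂μ := by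
  have hn' : (n : ℝ) ≠ 0 := by positivity
  have hS := memLp_two_sum_comp_eval (n := n) hX
  have hvar := variance_sum_pi (μ := fun _ : Fin n => μ) (X := fun _ => X) fun _ => hX
  rw [show (∑ i : Fin n, fun z : Fin n → Ω => X (z i)) = fun z => ∑ i, X (z i) from by
      ext z; simp, variance_eq_sub hS, variance_eq_sub hX,
    integral_sum_comp_eval (hX.integrable one_le_two)] at hvar
  simp only [Pi.pow_apply, Finset.sum_const, Finset.card_univ, Fintype.card_fin,
    nsmul_eq_mul] at hvar
  simp_rw [mul_pow]
  rw [integral_const_mul, eq_add_of_sub_eq hvar]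
  field_simp
  ring

end SampleMean

/-- For `z_1, …, z_n` i.i.d. standard Gaussians in `ℝ^d`, a diagonal `Σ` with
strictly positive diagonal `σ`, `M = Σ^{-1/2}` and fixed `g`, the averaged
preconditioned estimator `u = (1/n) ∑_j M z_j z_jᵀ M g` satisfies
`E[u] = Σ⁻¹ g`,
`E[‖u‖²] = (1 − 1/n)(gᵀ Σ⁻² g) + (1/n)(tr(Σ⁻¹)(gᵀ Σ⁻¹ g) + 2 gᵀ Σ⁻² g)`,
and in particular `E[‖u‖²] ≤ tr(Σ⁻¹)(gᵀ Σ⁻¹ g) + 2 gᵀ Σ⁻² g`.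
Here `M z zᵀ M g = (zᵀ M g) · (M z)`. -/
theorem averaged_preconditioned_estimator_moments
    (n d : ℕ) (hn : 0 < n) (σ : Fin d → ℝ) (hσ : ∀ i, 0 < σ i) (g : Fin d → ℝ) :
    (∫ z, (1 / (n : ℝ)) •
        ∑ j, (z j ⬝ᵥ (invSqrtDiag σ).mulVec g) • (invSqrtDiag σ).mulVec (z j)
        ∂(iidStdGaussian n d))
      = (Matrix.diagonal fun i => (σ i)⁻¹).mulVec g ∧
    (∫ z, ∑ k, ((1 / (n : ℝ)) *
        ∑ j, (z j ⬝ᵥ (invSqrtDiag σ).mulVec g) * ((invSqrtDiag σ).mulVec (z j) k)) ^ 2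
        ∂(iidStdGaussian n d))
      = (1 - 1 / (n : ℝ)) * (g ⬝ᵥ (Matrix.diagonal fun i => ((σ i) ^ 2)⁻¹).mulVec g)
        + (1 / (n : ℝ)) *
          ((Matrix.diagonal fun i => (σ i)⁻¹).trace
              * (g ⬝ᵥ (Matrix.diagonal fun i => (σ i)⁻¹).mulVec g)
            + 2 * (g ⬝ᵥ (Matrix.diagonal fun i => ((σ i) ^ 2)⁻¹).mulVec g)) ∧
    (∫ z, ∑ k, ((1 / (n : ℝ)) *
        ∑ j, (z j ⬝ᵥ (invSqrtDiag σ).mulVec g) * ((invSqrtDiag σ).mulVec (z j) k)) ^ 2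
        ∂(iidStdGaussian n d))
      ≤ (Matrix.diagonal fun i => (σ i)⁻¹).trace
          * (g ⬝ᵥ (Matrix.diagonal fun i => (σ i)⁻¹).mulVec g)
        + 2 * (g ⬝ᵥ (Matrix.diagonal fun i => ((σ i) ^ 2)⁻¹).mulVec g) := by
  set h : Fin d → ℝ := (invSqrtDiag σ).mulVec g with hh
  set m : Fin d → ℝ := fun i => (Real.sqrt (σ i))⁻¹ with hm
  have hmsq (i : Fin d) : m i ^ 2 = (σ i)⁻¹ := by
    rw [hm, inv_pow, Real.sq_sqrt (hσ i).le]
  have hhm (i : Fin d) : h i = m i * g i := by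
    rw [hh, invSqrtDiag, mulVec_diagonal]
  have hM (x : Fin d → ℝ) (k : Fin d) : (invSqrtDiag σ).mulVec x k = m k * x k := by
    rw [invSqrtDiag, mulVec_diagonal]
  have hL (k : Fin d) := memLp_two_dotProduct_mul_coord h (m k) k
  have hI (k : Fin d) := (hL k).integrable one_le_two
  have hquad₁ : g ⬝ᵥ (Matrix.diagonal fun i => (σ i)⁻¹).mulVec g = ∑ i, h i ^ 2 := by
    refine Finset.sum_congr rfl fun i _ => ?_
    rw [mulVec_diagonal, hhm, mul_pow, hmsq]
    ring
  have hquad₂ : g ⬝ᵥ (Matrix.diagonal fun i => ((σ i) ^ 2)⁻¹).mulVec g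
      = ∑ i, (h i * m i) ^ 2 := by
    refine Finset.sum_congr rfl fun i _ => ?_
    rw [mulVec_diagonal, hhm, mul_pow, mul_pow, hmsq, ← inv_pow]
    ring
  have htr : (Matrix.diagonal fun i => (σ i)⁻¹).trace = ∑ i, m i ^ 2 := by
    simp_rw [trace_diagonal, hmsq]
  have hsecond : (∫ z, ∑ k, ((1 / (n : ℝ)) *
        ∑ j, (z j ⬝ᵥ h) * ((invSqrtDiag σ).mulVec (z j) k)) ^ 2 ∂(iidStdGaussian n d))
      = (1 - 1 / (n : ℝ)) * ∑ i, (h i * m i) ^ 2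
        + (1 / (n : ℝ)) * ((∑ i, m i ^ 2) * ∑ i, h i ^ 2 + 2 * ∑ i, (h i * m i) ^ 2) := by
    simp_rw [hM]
    unfold iidStdGaussian
    rw [integral_finsetSum _ fun k _ =>
      ((memLp_two_sum_comp_eval (hL k)).const_mul (1 / (n : ℝ))).integrable_sq]
    simp_rw [fun k => integral_sq_sampleMean hn (hL k), integral_dotProduct_mul_coord,
      integral_sq_dotProduct_mul_coord]
    rw [Finset.sum_add_distrib, ← Finset.mul_sum, ← Finset.mul_sum]
    congr 2
    rw [Finset.sum_mul, Finset.mul_sum, ← Finset.sum_add_distrib]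
    exact Finset.sum_congr rfl fun k _ => by ring
  rw [hquad₁, hquad₂, htr, hsecond]
  refine ⟨?_, rfl, ?_⟩
  · ext k
    unfold iidStdGaussian
    have heval (z : Fin n → Fin d → ℝ) (k : Fin d) : ((1 / (n : ℝ)) •
        ∑ j, (z j ⬝ᵥ h) • (invSqrtDiag σ).mulVec (z j)) k
        = (1 / (n : ℝ)) * ∑ j, (z j ⬝ᵥ h) * (m k * z j k) := by
      simp [hM]
    rw [eval_integral fun k => by
      simp_rw [heval]
      exact (integrable_sum_comp_eval (hI k)).const_mul _]
    simp_rw [heval]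
    rw [integral_const_mul, integral_sum_comp_eval (hI k), integral_dotProduct_mul_coord,
      mulVec_diagonal, hhm, ← hmsq]
    field_simp
  · have hn₁ : 1 / (n : ℝ) ≤ 1 := by
      rw [div_le_one (by positivity)]
      exact_mod_cast hn
    have hA : 0 ≤ ∑ i, (h i * m i) ^ 2 := by positivity
    have hB : 0 ≤ (∑ i, m i ^ 2) * ∑ i, h i ^ 2 := by positivity
    nlinarith [mul_nonneg (sub_nonneg.2 hn₁) (add_nonneg hA hB)]
end
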